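/- (Companion intertwining identity from the proof of the section proposition) For every A ∈ M_n(F) and every column vector u ∈ F^n, one has A·δ_+ = δ_+·C(a), where δ_+ ∈ M_n(F) is the matrix whose j-th column is A^{n−j}·u for 1 ≤ j ≤ n, a = (a_1,…,a_n) with a_i := −(the coefficient of T^{n−i} in the characteristic polynomial of A), and C(a) ∈ M_n(F) is the matrix whose (i,1)-entry is a_i for 1 ≤ i ≤ n, whose (i,i+1)-entry is 1 for 1 ≤ i ≤ n−1, and all of whose other entries are 0. -/

import Mathlib

open Matrix MeasureTheory

namespace ZhangRTF

variable {F : Type*} [Field F] {n : ℕ}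

/-- Block diagonal embedding `diag(h,1) ∈ M_{n+1}(F)` of `h ∈ M_n(F)`. -/
def emb (h : Matrix (Fin n) (Fin n) F) : Matrix (Fin (n + 1)) (Fin (n + 1)) F :=
  Matrix.of fun i j =>
    if hi : (i : ℕ) < n then
      (if hj : (j : ℕ) < n then h ⟨i, hi⟩ ⟨j, hj⟩ else 0)
    else (if (j : ℕ) < n then 0 else 1)

/-- Conjugation action of `GL_n(F)` on `M_{n+1}(F)`: `h·X = diag(h,1) X diag(h,1)⁻¹`. -/
def act (h : Matrix.GeneralLinearGroup (Fin n) F)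
    (X : Matrix (Fin (n + 1)) (Fin (n + 1)) F) : Matrix (Fin (n + 1)) (Fin (n + 1)) F :=
  emb (h : Matrix (Fin n) (Fin n) F) * X *
    emb ((h⁻¹ : Matrix.GeneralLinearGroup (Fin n) F) : Matrix (Fin n) (Fin n) F)

/-- The upper-left `n × n` block `A` of `X = [[A,u],[v,w]]`. -/
def blockA (X : Matrix (Fin (n + 1)) (Fin (n + 1)) F) : Matrix (Fin n) (Fin n) F :=
  Matrix.of fun i j => X i.castSucc j.castSucc

/-- The upper-right column `u` of `X = [[A,u],[v,w]]`. -/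
def blockU (X : Matrix (Fin (n + 1)) (Fin (n + 1)) F) : Fin n → F :=
  fun i => X i.castSucc (Fin.last n)

/-- The lower-left row `v` of `X = [[A,u],[v,w]]`. -/
def blockV (X : Matrix (Fin (n + 1)) (Fin (n + 1)) F) : Fin n → F :=
  fun j => X (Fin.last n) j.castSucc

/-- The lower-right corner `w` of `X = [[A,u],[v,w]]`. -/
def blockW (X : Matrix (Fin (n + 1)) (Fin (n + 1)) F) : F :=
  X (Fin.last n) (Fin.last n)

/-- `δ₊(X)`: the matrix whose `j`-th column is `A^{n-j} u` (`1 ≤ j ≤ n`, 1-indexed). -/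
def deltaPlus (X : Matrix (Fin (n + 1)) (Fin (n + 1)) F) : Matrix (Fin n) (Fin n) F :=
  Matrix.of fun i j => (blockA X ^ (n - 1 - (j : ℕ)) *ᵥ blockU X) i

/-- `δ₋(X)`: the matrix whose `i`-th row is `v A^{i-1}` (`1 ≤ i ≤ n`, 1-indexed). -/
def deltaMinus (X : Matrix (Fin (n + 1)) (Fin (n + 1)) F) : Matrix (Fin n) (Fin n) F :=
  Matrix.of fun i j => (blockV X ᵥ* blockA X ^ (i : ℕ)) j

/-- `Δ₊(X) = det δ₊(X)`. -/
def DeltaPlus (X : Matrix (Fin (n + 1)) (Fin (n + 1)) F) : F := (deltaPlus X).det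

/-- `Δ₋(X) = det δ₋(X)`. -/
def DeltaMinus (X : Matrix (Fin (n + 1)) (Fin (n + 1)) F) : F := (deltaMinus X).det

/-- The `a`-invariants: `a_i = -(coefficient of T^{n-i} in charpoly A)` (1-indexed). -/
noncomputable def aInv (X : Matrix (Fin (n + 1)) (Fin (n + 1)) F) : Fin n → F :=
  fun i => -((blockA X).charpoly.coeff (n - 1 - (i : ℕ)))

/-- The `b`-invariants: `b_0 = w` and `b_j = v A^{j-1} u` for `1 ≤ j ≤ n`. -/
def bInv (X : Matrix (Fin (n + 1)) (Fin (n + 1)) F) : Fin (n + 1) → F :=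
  fun j => if (j : ℕ) = 0 then blockW X
    else blockV X ⬝ᵥ (blockA X ^ ((j : ℕ) - 1) *ᵥ blockU X)

/-- The invariants map `π : M_{n+1}(F) → F^n × F^{n+1}`. -/
noncomputable def invMap (X : Matrix (Fin (n + 1)) (Fin (n + 1)) F) : (Fin n → F) × (Fin (n + 1) → F) :=
  (aInv X, bInv X)

/-- The regular nilpotent `ξ₊`: `(i,i+1)`-entries equal to `1`, all others `0`. -/
def xiPlus (n : ℕ) : Matrix (Fin (n + 1)) (Fin (n + 1)) F :=
  Matrix.of fun i j => if (j : ℕ) = (i : ℕ) + 1 then 1 else 0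

/-- The section `σ(a,b)` of the invariants map. -/
def sectSigma (a : Fin n → F) (b : Fin (n + 1) → F) : Matrix (Fin (n + 1)) (Fin (n + 1)) F :=
  Matrix.of fun i j =>
    if hi : (i : ℕ) < n then
      (if (j : ℕ) = 0 then a ⟨i, hi⟩ else 0) + (if (j : ℕ) = (i : ℕ) + 1 then 1 else 0)
    else b j.rev

/-- The variant section `σ'(a,b)`. -/
def sectSigma' (a : Fin n → F) (b : Fin (n + 1) → F) : Matrix (Fin (n + 1)) (Fin (n + 1)) F :=
  Matrix.of fun i j =>
    if (i : ℕ) < n - 1 then (if (j : ℕ) = (i : ℕ) + 1 then 1 else 0)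
    else if (i : ℕ) = n - 1 then
      (if hj : (j : ℕ) < n then a ⟨n - 1 - (j : ℕ), by omega⟩ else 1)
    else b j.rev

/-- Membership in `N_{n,-}`: lower triangular with unit diagonal. -/
def IsLowerUni (h : Matrix (Fin n) (Fin n) F) : Prop :=
  (∀ i, h i i = 1) ∧ ∀ i j : Fin n, i < j → h i j = 0

/-- Membership in `N_n`: upper triangular with unit diagonal. -/
def IsUpperUni (h : Matrix (Fin n) (Fin n) F) : Prop :=
  (∀ i, h i i = 1) ∧ ∀ i j : Fin n, j < i → h i j = 0

/-- Membership in the subvariety `𝒲`: superdiagonal entries `1`,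
entries above the superdiagonal `0`. -/
def memW (X : Matrix (Fin (n + 1)) (Fin (n + 1)) F) : Prop :=
  ∀ i j : Fin (n + 1),
    ((j : ℕ) = (i : ℕ) + 1 → X i j = 1) ∧ ((i : ℕ) + 1 < (j : ℕ) → X i j = 0)

/-- `p : 𝒲 → 𝒱`, replacing the last row by zero. -/
def pMap (X : Matrix (Fin (n + 1)) (Fin (n + 1)) F) : Matrix (Fin (n + 1)) (Fin (n + 1)) F :=
  Matrix.of fun i j => if (i : ℕ) = n then 0 else X i j

/-- `p' : 𝒲 → 𝒱'`, replacing the last row and the first column by zero. -/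
def pMap' (X : Matrix (Fin (n + 1)) (Fin (n + 1)) F) : Matrix (Fin (n + 1)) (Fin (n + 1)) F :=
  Matrix.of fun i j => if (i : ℕ) = n ∨ (j : ℕ) = 0 then 0 else X i j

/-- The determinant of an element of `GL_n(F)`, as a unit of `F`. -/
def GLdet (h : Matrix.GeneralLinearGroup (Fin n) F) : Fˣ :=
  Units.map Matrix.detMonoidHom h

end ZhangRTF

open ZhangRTF

/-- Companion intertwining identity: `A·δ₊ = δ₊·C(a)` where the `j`-th column of `δ₊`
is `A^{n-j}u` and `C(a)` is the companion-type matrix built from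
`a_i = -(coefficient of T^{n-i} in charpoly A)`. -/
theorem companion_identity (n : ℕ) (hn : 1 ≤ n) (F : Type*) [Field F]
    (A : Matrix (Fin n) (Fin n) F) (u : Fin n → F) :
    A * (Matrix.of fun i j : Fin n => (A ^ (n - 1 - (j : ℕ)) *ᵥ u) i) =
      (Matrix.of fun i j : Fin n => (A ^ (n - 1 - (j : ℕ)) *ᵥ u) i) *
        (Matrix.of fun i j : Fin n =>
          (if (j : ℕ) = 0 then -(A.charpoly.coeff (n - 1 - (i : ℕ))) else 0) +
            (if (j : ℕ) = (i : ℕ) + 1 then 1 else 0)) := by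
  have key : A ^ n = ∑ k ∈ Finset.range n, (-(A.charpoly.coeff k)) • A ^ k := by
    have h := A.aeval_self_charpoly
    have hd : A.charpoly.natDegree = n := by simp
    have hc : A.charpoly.coeff n = 1 := by
      have := A.charpoly_monic.coeff_natDegree
      rwa [hd] at this
    rw [Polynomial.aeval_eq_sum_range, hd, Finset.sum_range_succ, hc, one_smul] at h
    simp only [neg_smul, Finset.sum_neg_distrib]
    exact eq_neg_of_add_eq_zero_right h
  ext i j
  have hL : (A * (Matrix.of fun i j : Fin n => (A ^ (n - 1 - (j : ℕ)) *ᵥ u) i)) i j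
      = (A ^ (n - 1 - (j : ℕ) + 1) *ᵥ u) i := by
    rw [pow_succ', ← Matrix.mulVec_mulVec]
    rfl
  rw [hL, Matrix.mul_apply]
  simp only [Matrix.of_apply]
  by_cases hj : (j : ℕ) = 0
  · have h1 : n - 1 - (j : ℕ) + 1 = n := by omega
    have h2 : ∀ x : Fin n, ¬ ((j : ℕ) = (x : ℕ) + 1) := fun x => by omega
    simp only [h1, h2, if_false, add_zero, if_pos hj]
    rw [key, Matrix.sum_mulVec, Finset.sum_apply, ← Finset.sum_range_reflect,
      Finset.sum_range]
    refine Finset.sum_congr rfl fun x _ => ?_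
    rw [Matrix.smul_mulVec, Pi.smul_apply, smul_eq_mul, mul_comm]
  · have hlt := j.isLt
    rw [Finset.sum_eq_single (⟨(j : ℕ) - 1, by omega⟩ : Fin n)]
    · have h1 : (j : ℕ) = (j : ℕ) - 1 + 1 := by omega
      have h2 : n - 1 - ((j : ℕ) - 1) = n - 1 - (j : ℕ) + 1 := by omega
      simp only [if_neg hj, if_pos h1, zero_add, mul_one, h2]
    · intro b _ hb
      have h1 : ¬ ((j : ℕ) = (b : ℕ) + 1) := fun h => hb (Fin.ext (by simp [h]))
      simp only [if_neg hj, if_neg h1, add_zero, mul_zero]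
    · intro h
      exact absurd (Finset.mem_univ _) h
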